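/- arXiv:1411.6156 — 3 statements merged into one kernel-verified Lean document; each statement's English description precedes it below -/
import Mathlib

section
/- For any node u ∈ V and any subset S ⊆ V∖{u} such that ∂u ⊄ S, there exists a neighbor i ∈ ∂u∖S with conditional mutual information I(X_u ; X_i | X_S) ≥ 2·(τ*)², where τ* = α²·δ^{4d+1}/(16dβ). In particular, taking S = ∅, every node u with at least one neighbor has a neighbor i with I(X_u ; X_i) ≥ 2·(τ*)². -/
noncomputable section

open Real Finset

/-- The spin value (±1) associated to a Boolean. -/
def spin (b : Bool) : ℝ := if b then 1 else -1

/-- The energy (Hamiltonian, without normalization) of a configuration of the Ising model: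
`Σ_{{i,j}∈E} θ_{ij} x_i x_j + Σ_{i∈V} θ_i x_i`, where the sum over edges is written as half the
sum over ordered adjacent pairs (the edge couplings are symmetric). -/
def energy {p : ℕ} (G : SimpleGraph (Fin p)) [DecidableRel G.Adj]
    (θe : Fin p → Fin p → ℝ) (θv : Fin p → ℝ) (x : Fin p → Bool) : ℝ :=
  (∑ i, ∑ j, if G.Adj i j then θe i j * spin (x i) * spin (x j) else 0) / 2
    + ∑ i, θv i * spin (x i)

/-- The Ising model probability mass function
`P(x) = exp(Σ_{{i,j}∈E} θ_{ij} x_i x_j + Σ_{i∈V} θ_i x_i − Φ(θ))`. -/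
def isingPMF {p : ℕ} (G : SimpleGraph (Fin p)) [DecidableRel G.Adj]
    (θe : Fin p → Fin p → ℝ) (θv : Fin p → ℝ) (x : Fin p → Bool) : ℝ :=
  Real.exp (energy G θe θv x) / ∑ y : Fin p → Bool, Real.exp (energy G θe θv y)

open Classical in
/-- Probability of an event under a pmf on configurations. -/
def prob {p : ℕ} (μ : (Fin p → Bool) → ℝ) (A : (Fin p → Bool) → Prop) : ℝ :=
  ∑ x : Fin p → Bool, if A x then μ x else 0

/-- Conditional probability `P(A | B)`. -/
def condProb {p : ℕ} (μ : (Fin p → Bool) → ℝ) (A B : (Fin p → Bool) → Prop) : ℝ :=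
  prob μ (fun x => A x ∧ B x) / prob μ B

open Classical in
/-- Conditional expectation `E[f(X) | B]`. -/
def condExp {p : ℕ} (μ : (Fin p → Bool) → ℝ) (B : (Fin p → Bool) → Prop)
    (f : (Fin p → Bool) → ℝ) : ℝ :=
  (∑ x : Fin p → Bool, if B x then μ x * f x else 0) / prob μ B

/-- The event `X_S = σ_S` (agreement with `σ` on the set `S`). -/
def agree {p : ℕ} (S : Finset (Fin p)) (σ : Fin p → Bool) (x : Fin p → Bool) : Prop :=
  ∀ i ∈ S, x i = σ i

/-- The conditional influence
`ν_{u|i;x_S} = P(X_u=+1 | X_i=+1, X_S=x_S) − P(X_u=+1 | X_i=−1, X_S=x_S)`. -/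
def condInf {p : ℕ} (μ : (Fin p → Bool) → ℝ) (u i : Fin p) (S : Finset (Fin p))
    (σ : Fin p → Bool) : ℝ :=
  condProb μ (fun x => x u = true) (fun x => x i = true ∧ agree S σ x)
    - condProb μ (fun x => x u = true) (fun x => x i = false ∧ agree S σ x)

/-- The weight `λ_i(x_S) = 2·P(X_i=+1|X_S=x_S)·P(X_i=−1|X_S=x_S)`. -/
def lamWeight {p : ℕ} (μ : (Fin p → Bool) → ℝ) (i : Fin p) (S : Finset (Fin p))
    (σ : Fin p → Bool) : ℝ :=
  2 * condProb μ (fun x => x i = true) (agree S σ)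
    * condProb μ (fun x => x i = false) (agree S σ)

/-- The average conditional influence `ν̄(u,i,S) = E[λ_i(X_S)·|ν_{u|i;X_S}|]`, the expectation
over `X_S` with law the marginal of `μ` on `S` (the integrand depends on the configuration only
through its restriction to `S`). -/
def avgInf {p : ℕ} (μ : (Fin p → Bool) → ℝ) (u i : Fin p) (S : Finset (Fin p)) : ℝ :=
  ∑ x : Fin p → Bool, μ x * (lamWeight μ i S x * |condInf μ u i S x|)

/-- `δ = (1/2)·e^{−2(βd+h)}`. -/
def deltaLB (β h : ℝ) (d : ℕ) : ℝ := (1/2) * Real.exp (-(2 * (β * d + h)))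

/-- `τ* = α²·δ^{4d+1}/(16dβ)`. -/
def tauStar (α β h : ℝ) (d : ℕ) : ℝ :=
  α ^ 2 * (deltaLB β h d) ^ (4 * d + 1) / (16 * d * β)

/-- The conditional mutual information `I(X_u ; X_i | X_S)`, computed with natural logarithms,
written as the expectation of the log-likelihood ratio
`log( P(X_u,X_i,X_S)·P(X_S) / (P(X_u,X_S)·P(X_i,X_S)) )`. -/
def condMI {p : ℕ} (μ : (Fin p → Bool) → ℝ) (u i : Fin p) (S : Finset (Fin p)) : ℝ :=
  ∑ x : Fin p → Bool, μ x * Real.log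
    ((prob μ (fun z => z u = x u ∧ z i = x i ∧ agree S x z) * prob μ (agree S x))
      / (prob μ (fun z => z u = x u ∧ agree S x z)
          * prob μ (fun z => z i = x i ∧ agree S x z)))

lemma spin_not (b : Bool) : spin (!b) = -spin b := by
  cases b <;> simp [spin]

lemma spin_mul_self (b : Bool) : spin b * spin b = 1 := by
  cases b <;> simp [spin]

lemma abs_spin (b : Bool) : |spin b| = 1 := by
  cases b <;> simp [spin]

/-- The configuration obtained from `x` by flipping the spin at `u`. -/
def flipAt {p : ℕ} (u : Fin p) (x : Fin p → Bool) : Fin p → Bool :=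
  Function.update x u (!x u)

lemma flipAt_self {p : ℕ} (u : Fin p) (x : Fin p → Bool) : flipAt u x u = !x u := by
  simp [flipAt]

lemma flipAt_of_ne {p : ℕ} {u j : Fin p} (hj : j ≠ u) (x : Fin p → Bool) :
    flipAt u x j = x j := by
  simp [flipAt, hj]

lemma flipAt_involutive {p : ℕ} (u : Fin p) : Function.Involutive (flipAt u) := by
  intro x
  funext j
  by_cases hj : j = u
  · subst hj; simp [flipAt_self]
  · simp [flipAt_of_ne hj]

lemma sum_comp_flipAt {p : ℕ} (u : Fin p) (f : (Fin p → Bool) → ℝ) :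
    ∑ x, f (flipAt u x) = ∑ x, f x :=
  Equiv.sum_comp (flipAt_involutive u).toPerm f

lemma agree_refl {p : ℕ} (S : Finset (Fin p)) (x : Fin p → Bool) : agree S x x :=
  fun _ _ => rfl

lemma agree.symm {p : ℕ} {S : Finset (Fin p)} {x y : Fin p → Bool} (hxy : agree S x y) :
    agree S y x :=
  fun i hi => (hxy i hi).symm

lemma agree.trans {p : ℕ} {S : Finset (Fin p)} {x y z : Fin p → Bool} (hxy : agree S x y)
    (hyz : agree S y z) : agree S x z :=
  fun i hi => (hyz i hi).trans (hxy i hi)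

lemma agree.congr_left {p : ℕ} {S : Finset (Fin p)} {x y : Fin p → Bool} (hxy : agree S x y) :
    agree S x = agree S y := by
  funext z
  exact propext ⟨fun hz => hxy.symm.trans hz, fun hz => hxy.trans hz⟩

lemma agree_flipAt {p : ℕ} {S : Finset (Fin p)} {u : Fin p} (hu : u ∉ S) (x : Fin p → Bool) :
    agree S x (flipAt u x) :=
  fun _ hi => flipAt_of_ne (ne_of_mem_of_not_mem hi hu) x

lemma prob_mul {p : ℕ} (μ : (Fin p → Bool) → ℝ) (A : (Fin p → Bool) → Prop)
    [DecidablePred A] (c : ℝ) : prob μ A * c = ∑ x, if A x then μ x * c else 0 := by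
  rw [prob, Finset.sum_mul]
  refine Finset.sum_congr rfl fun x _ => ?_
  by_cases hx : A x <;> simp [hx]

lemma prob_pos {p : ℕ} {μ : (Fin p → Bool) → ℝ} (hμ : ∀ x, 0 < μ x)
    {A : (Fin p → Bool) → Prop} {x : Fin p → Bool} (hx : A x) : 0 < prob μ A := by
  refine Finset.sum_pos' (fun y _ => ?_) ⟨x, Finset.mem_univ _, ?_⟩
  · split_ifs
    exacts [(hμ y).le, le_rfl]
  · simpa [hx] using hμ x

open Classical in
/-- The joint law of two configurations which coincide on `S` and are conditionally independent
given their common restriction to `S`, each with law `μ`. -/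
def replicaPMF {p : ℕ} (μ : (Fin p → Bool) → ℝ) (S : Finset (Fin p)) (y z : Fin p → Bool) : ℝ :=
  if agree S y z then μ y * μ z / prob μ (agree S y) else 0

lemma replicaPMF_comm {p : ℕ} (μ : (Fin p → Bool) → ℝ) (S : Finset (Fin p))
    (y z : Fin p → Bool) : replicaPMF μ S y z = replicaPMF μ S z y := by
  unfold replicaPMF
  by_cases hyz : agree S y z
  · rw [if_pos hyz, if_pos hyz.symm, hyz.congr_left, mul_comm]
  · rw [if_neg hyz, if_neg (fun hzy => hyz hzy.symm)]

lemma replicaPMF_nonneg {p : ℕ} {μ : (Fin p → Bool) → ℝ} (hμ : ∀ x, 0 < μ x)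
    (S : Finset (Fin p)) (y z : Fin p → Bool) : 0 ≤ replicaPMF μ S y z := by
  unfold replicaPMF
  split_ifs
  · exact div_nonneg (mul_pos (hμ y) (hμ z)).le (prob_pos hμ (agree_refl S y)).le
  · exact le_rfl

lemma sum_replicaPMF {p : ℕ} {μ : (Fin p → Bool) → ℝ} (hμ : ∀ x, 0 < μ x)
    (S : Finset (Fin p)) (y : Fin p → Bool) : ∑ z, replicaPMF μ S y z = μ y := by
  have hq := (prob_pos hμ (agree_refl S y)).ne'
  classical
  calc ∑ z, replicaPMF μ S y z = prob μ (agree S y) * (μ y / prob μ (agree S y)) := by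
        rw [prob_mul]
        refine Finset.sum_congr rfl fun z _ => ?_
        by_cases hz : agree S y z
        · rw [replicaPMF, if_pos hz, if_pos hz]; ring
        · rw [replicaPMF, if_neg hz, if_neg hz]
    _ = μ y := mul_div_cancel₀ _ hq

/-- The likelihood ratio of the conditionally independent coupling of `X_u` and `X_i` given `X_S`
with respect to their actual joint law. -/
def indepRatio {p : ℕ} (μ : (Fin p → Bool) → ℝ) (u i : Fin p) (S : Finset (Fin p))
    (x : Fin p → Bool) : ℝ :=
  (prob μ (fun z => z u = x u ∧ agree S x z) * prob μ (fun z => z i = x i ∧ agree S x z))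
    / (prob μ (fun z => z u = x u ∧ z i = x i ∧ agree S x z) * prob μ (agree S x))

lemma indepRatio_pos {p : ℕ} {μ : (Fin p → Bool) → ℝ} (hμ : ∀ x, 0 < μ x) (u i : Fin p)
    (S : Finset (Fin p)) (x : Fin p → Bool) : 0 < indepRatio μ u i S x := by
  have := agree_refl S x
  exact div_pos
    (mul_pos (prob_pos hμ (x := x) ⟨rfl, this⟩) (prob_pos hμ (x := x) ⟨rfl, this⟩))
    (mul_pos (prob_pos hμ (x := x) ⟨rfl, rfl, this⟩) (prob_pos hμ (x := x) this))

lemma condMI_eq_sum_neg_log {p : ℕ} (μ : (Fin p → Bool) → ℝ) (u i : Fin p)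
    (S : Finset (Fin p)) :
    condMI μ u i S = ∑ x, μ x * -Real.log (indepRatio μ u i S x) := by
  refine Finset.sum_congr rfl fun x _ => ?_
  rw [← Real.log_inv, indepRatio, inv_div]

lemma sum_mul_indepRatio {p : ℕ} {μ : (Fin p → Bool) → ℝ} (hμ : ∀ x, 0 < μ x) {u i : Fin p}
    (hui : u ≠ i) {S : Finset (Fin p)} (hi : i ∉ S) (g : Bool → Bool → ℝ) :
    ∑ x, μ x * (g (x u) (x i) * indepRatio μ u i S x)
      = ∑ y, ∑ z, replicaPMF μ S y z * g (y u) (z i) := by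
  classical
  have expand : ∀ x, μ x * (g (x u) (x i) * indepRatio μ u i S x)
      = ∑ y, ∑ z, if (y u = x u ∧ agree S x y) ∧ (z i = x i ∧ agree S x z) then
          μ x * (g (x u) (x i) * (μ y * μ z
            / (prob μ (fun z => z u = x u ∧ z i = x i ∧ agree S x z) * prob μ (agree S x))))
          else 0 := by
    intro x
    rw [indepRatio, prob, prob, Finset.sum_mul_sum, Finset.sum_div, Finset.mul_sum,
      Finset.mul_sum]
    refine Finset.sum_congr rfl fun y _ => ?_
    rw [Finset.sum_div, Finset.mul_sum, Finset.mul_sum]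
    refine Finset.sum_congr rfl fun z _ => ?_
    by_cases h1 : y u = x u ∧ agree S x y <;> by_cases h2 : z i = x i ∧ agree S x z <;>
      simp [h1, h2]
  rw [Finset.sum_congr rfl fun x _ => expand x, Finset.sum_comm]
  refine Finset.sum_congr rfl fun y _ => ?_
  rw [Finset.sum_comm]
  refine Finset.sum_congr rfl fun z _ => ?_
  by_cases hyz : agree S y z
  · set w := Function.update y i (z i) with hw
    have hwu : w u = y u := by simp [hw, hui]
    have hwi : w i = z i := by simp [hw]
    have hyw : agree S y w := fun j hj => by
      have : j ≠ i := ne_of_mem_of_not_mem hj hi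
      simp [hw, this]
    have hcond : ∀ x, ((y u = x u ∧ agree S x y) ∧ (z i = x i ∧ agree S x z))
        ↔ (x u = w u ∧ x i = w i ∧ agree S w x) := by
      intro x
      rw [hwu, hwi, ← hyw.congr_left]
      exact ⟨fun ⟨⟨h1, h2⟩, h3, _⟩ => ⟨h1.symm, h3.symm, h2.symm⟩,
        fun ⟨h1, h2, h3⟩ => ⟨⟨h1.symm, h3.symm⟩, h2.symm, h3.symm.trans hyz⟩⟩
    have ha : 0 < prob μ (fun x => x u = w u ∧ x i = w i ∧ agree S w x) :=
      prob_pos hμ (x := w) ⟨rfl, rfl, agree_refl S w⟩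
    have hq := prob_pos hμ (agree_refl S y)
    calc _ = prob μ (fun x => x u = w u ∧ x i = w i ∧ agree S w x)
            * (g (y u) (z i) * (μ y * μ z
              / (prob μ (fun x => x u = w u ∧ x i = w i ∧ agree S w x)
                * prob μ (agree S y)))) := by
          rw [prob_mul]
          refine Finset.sum_congr rfl fun x _ => ?_
          by_cases hx : x u = w u ∧ x i = w i ∧ agree S w x
          · rw [if_pos ((hcond x).2 hx), if_pos hx]
            obtain ⟨h1, h2, h3⟩ := hx
            rw [h1, h2, ← h3.congr_left, ← hyw.congr_left, hwu, hwi]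
          · rw [if_neg (fun hx' => hx ((hcond x).1 hx')), if_neg hx]
      _ = _ := by
          rw [replicaPMF, if_pos hyz]
          field_simp
  · rw [replicaPMF, if_neg hyz, zero_mul]
    refine Finset.sum_eq_zero fun x _ => if_neg ?_
    rintro ⟨⟨_, h1⟩, _, h2⟩
    exact hyz (h1.symm.trans h2)

/-- A Pinsker-type inequality: the relative entropy controls the square of the difference of the
expectations of a function bounded by one. -/
lemma sq_sum_mul_one_sub_le_neg_log {ι : Type*} [Fintype ι] {μ r g : ι → ℝ}
    (hμ : ∀ x, 0 ≤ μ x) (hr : ∀ x, 0 < r x) (hμ1 : ∑ x, μ x = 1) (hr1 : ∑ x, μ x * r x = 1)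
    (hg : ∀ x, |g x| ≤ 1) :
    (∑ x, μ x * (g x * (1 - r x))) ^ 2 ≤ 4 * ∑ x, μ x * -Real.log (r x) := by
  have hsq : ∀ x, √(r x) * √(r x) = r x := fun x => Real.mul_self_sqrt (hr x).le
  have hpos : ∀ x, 0 < √(r x) := fun x => Real.sqrt_pos.2 (hr x)
  have hent : ∑ x, (√(μ x) * (1 - √(r x))) ^ 2 ≤ ∑ x, μ x * -Real.log (r x) := by
    have h0 : ∑ x, μ x * (1 - r x) = 0 := by
      simp only [mul_sub, mul_one, Finset.sum_sub_distrib, hμ1, hr1, sub_self]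
    have h1 : ∑ x, (√(μ x) * (1 - √(r x))) ^ 2
        = ∑ x, μ x * (2 * (1 - √(r x))) - ∑ x, μ x * (1 - r x) := by
      rw [← Finset.sum_sub_distrib]
      refine Finset.sum_congr rfl fun x _ => ?_
      rw [mul_pow, Real.sq_sqrt (hμ x)]
      linear_combination μ x * hsq x
    rw [h1, h0, sub_zero]
    refine Finset.sum_le_sum fun x _ => mul_le_mul_of_nonneg_left ?_ (hμ x)
    have h2 := Real.log_le_sub_one_of_pos (hpos x)
    rw [Real.log_sqrt (hr x).le] at h2
    linarith
  have hbdd : ∑ x, (√(μ x) * (g x * (1 + √(r x)))) ^ 2 ≤ 4 := by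
    calc ∑ x, (√(μ x) * (g x * (1 + √(r x)))) ^ 2 ≤ ∑ x, (2 * μ x + 2 * (μ x * r x)) := by
          refine Finset.sum_le_sum fun x _ => ?_
          rw [mul_pow, Real.sq_sqrt (hμ x), mul_pow]
          have h1 : g x ^ 2 ≤ 1 := (sq_le_one_iff_abs_le_one _).2 (hg x)
          have h2 : (1 + √(r x)) ^ 2 ≤ 2 + 2 * r x := by
            nlinarith [sq_nonneg (1 - √(r x)), hsq x]
          have h3 : g x ^ 2 * (1 + √(r x)) ^ 2 ≤ 1 * (2 + 2 * r x) :=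
            mul_le_mul h1 h2 (sq_nonneg _) zero_le_one
          nlinarith [mul_le_mul_of_nonneg_left h3 (hμ x)]
      _ = 4 := by
          rw [Finset.sum_add_distrib, ← Finset.mul_sum, ← Finset.mul_sum, hμ1, hr1]
          norm_num
  calc (∑ x, μ x * (g x * (1 - r x))) ^ 2
      = (∑ x, (√(μ x) * (g x * (1 + √(r x)))) * (√(μ x) * (1 - √(r x)))) ^ 2 := by
        congr 1
        refine Finset.sum_congr rfl fun x _ => ?_
        linear_combination (-(g x * (1 - r x))) * Real.mul_self_sqrt (hμ x)
          + √(μ x) * √(μ x) * g x * hsq x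
    _ ≤ (∑ x, (√(μ x) * (g x * (1 + √(r x)))) ^ 2) * ∑ x, (√(μ x) * (1 - √(r x))) ^ 2 :=
        Finset.sum_mul_sq_le_sq_mul_sq _ _ _
    _ ≤ 4 * ∑ x, μ x * -Real.log (r x) :=
        mul_le_mul hbdd hent (Finset.sum_nonneg fun _ _ => sq_nonneg _) (by norm_num)

/-- The averaged conditional covariance `E[Cov(X_u, X_i | X_S)]`, expressed through a pair of
conditionally independent replicas. -/
def avgCov {p : ℕ} (μ : (Fin p → Bool) → ℝ) (u i : Fin p) (S : Finset (Fin p)) : ℝ :=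
  ∑ y, ∑ z, replicaPMF μ S y z * (spin (y u) * (spin (y i) - spin (z i)))

lemma avgCov_sq_le_condMI {p : ℕ} {μ : (Fin p → Bool) → ℝ} (hμ : ∀ x, 0 < μ x)
    (hμ1 : ∑ x, μ x = 1) {u i : Fin p} (hui : u ≠ i) {S : Finset (Fin p)} (hi : i ∉ S) :
    avgCov μ u i S ^ 2 ≤ 4 * condMI μ u i S := by
  have hr1 : ∑ x, μ x * indepRatio μ u i S x = 1 := by
    have := sum_mul_indepRatio hμ hui hi (fun _ _ => 1)
    simpa [sum_replicaPMF hμ, hμ1] using this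
  have hcov : avgCov μ u i S
      = ∑ x, μ x * ((spin (x u) * spin (x i)) * (1 - indepRatio μ u i S x)) := by
    have h1 := sum_mul_indepRatio hμ hui hi (fun a b => spin a * spin b)
    simp only [mul_sub, mul_one, Finset.sum_sub_distrib, h1, avgCov]
    congr 1
    refine Finset.sum_congr rfl fun y _ => ?_
    rw [← Finset.sum_mul, sum_replicaPMF hμ]
  rw [hcov, condMI_eq_sum_neg_log]
  exact sq_sum_mul_one_sub_le_neg_log (fun x => (hμ x).le) (indepRatio_pos hμ u i S) hμ1 hr1
    (fun x => by rw [abs_mul, abs_spin, abs_spin, one_mul])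

lemma exp_neg_mul_sq_le_tanh_sub {M a b : ℝ} (ha : |a| ≤ M) (hb : |b| ≤ M) :
    Real.exp (-(2 * M)) * (a - b) ^ 2 ≤ (Real.tanh a - Real.tanh b) * (a - b) := by
  have hcosh : ∀ t : ℝ, |t| ≤ M → Real.cosh t ≤ Real.exp M := by
    intro t ht
    rw [Real.cosh_eq]
    have h1 := Real.exp_le_exp.2 ((le_abs_self t).trans ht)
    have h2 := Real.exp_le_exp.2 ((neg_le_abs t).trans ht)
    linarith
  have hsinh : (a - b) ^ 2 ≤ Real.sinh (a - b) * (a - b) := by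
    rcases le_total 0 (a - b) with h0 | h0
    · nlinarith [Real.self_le_sinh_iff.2 h0]
    · nlinarith [Real.sinh_le_self_iff.2 h0]
  have hca := Real.cosh_pos a
  have hcb := Real.cosh_pos b
  have hprod : Real.exp (-(2 * M)) * (Real.cosh a * Real.cosh b) ≤ 1 := by
    calc _ ≤ Real.exp (-(2 * M)) * (Real.exp M * Real.exp M) := by
          gcongr
          exacts [hcosh a ha, hcosh b hb]
      _ = 1 := by rw [← Real.exp_add, ← Real.exp_add]; ring_nf; exact Real.exp_zero
  have heq : (Real.tanh a - Real.tanh b) * (a - b)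
      = Real.sinh (a - b) * (a - b) / (Real.cosh a * Real.cosh b) := by
    rw [Real.tanh_eq_sinh_div_cosh, Real.tanh_eq_sinh_div_cosh, Real.sinh_sub]
    field_simp
  rw [heq, le_div_iff₀ (mul_pos hca hcb)]
  nlinarith [mul_le_mul_of_nonneg_right hprod (sq_nonneg (a - b))]

/-- The local field acting on the spin at `u`. -/
def localField {p : ℕ} (θe : Fin p → Fin p → ℝ) (θv : Fin p → ℝ) (u : Fin p)
    (x : Fin p → Bool) : ℝ :=
  ∑ j, θe u j * spin (x j) + θv u

lemma localField_flipAt_self {p : ℕ} {θe : Fin p → Fin p → ℝ} (θv : Fin p → ℝ) {u : Fin p}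
    (huu : θe u u = 0) (x : Fin p → Bool) :
    localField θe θv u (flipAt u x) = localField θe θv u x := by
  unfold localField
  congr 1
  refine Finset.sum_congr rfl fun j _ => ?_
  by_cases hj : j = u
  · rw [hj, huu, zero_mul, zero_mul]
  · rw [flipAt_of_ne hj]

lemma energy_flipAt {p : ℕ} (G : SimpleGraph (Fin p)) [DecidableRel G.Adj]
    {θe : Fin p → Fin p → ℝ} (θv : Fin p → ℝ) (hsym : ∀ i j, θe i j = θe j i)
    (hnonedge : ∀ i j, ¬ G.Adj i j → θe i j = 0) (u : Fin p) (x : Fin p → Bool) :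
    energy G θe θv (flipAt u x)
      = energy G θe θv x - 2 * (spin (x u) * localField θe θv u x) := by
  have huu : θe u u = 0 := hnonedge u u (G.irrefl)
  have hθ : ∀ y : Fin p → Bool, energy G θe θv y
      = (∑ i, ∑ j, θe i j * spin (y i) * spin (y j)) / 2 + ∑ i, θv i * spin (y i) := by
    intro y
    unfold energy
    congr 2
    refine Finset.sum_congr rfl fun i _ => Finset.sum_congr rfl fun j _ => ?_
    split_ifs with hij
    · rfl
    · rw [hnonedge i j hij, zero_mul, zero_mul]
  have hs : ∀ j, spin (flipAt u x j) = spin (x j) + (if j = u then -2 * spin (x u) else 0) := by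
    intro j
    by_cases hj : j = u
    · subst hj; rw [flipAt_self, spin_not, if_pos rfl]; ring
    · rw [flipAt_of_ne hj, if_neg hj, add_zero]
  have hcol : ∑ i, θe i u * spin (x i) = ∑ j, θe u j * spin (x j) :=
    Finset.sum_congr rfl fun i _ => by rw [hsym]
  have hquad : ∑ i, ∑ j, θe i j * spin (flipAt u x i) * spin (flipAt u x j)
      = ∑ i, ∑ j, θe i j * spin (x i) * spin (x j)
        - 4 * (spin (x u) * ∑ j, θe u j * spin (x j)) := by
    have hinner : ∀ i, ∑ j, θe i j * spin (flipAt u x i) * spin (flipAt u x j)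
        = ∑ j, θe i j * spin (x i) * spin (x j)
          + θe i u * spin (x i) * (-2 * spin (x u))
          + (if i = u then -2 * spin (x u) * ∑ j, θe u j * spin (x j) else 0) := by
      intro i
      simp only [hs, mul_add, add_mul, Finset.sum_add_distrib, mul_ite, mul_zero,
        Finset.sum_ite_eq', Finset.mem_univ, if_true, ite_mul, zero_mul]
      by_cases hi : i = u
      · subst hi
        simp only [if_true, huu, Finset.mul_sum]
        have : ∀ j, θe i j * (-2 * spin (x i)) * spin (x j)
            = -2 * spin (x i) * (θe i j * spin (x j)) := fun j => by ring
        simp only [this]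
        ring
      · simp [hi]
    simp only [hinner, Finset.sum_add_distrib, Finset.sum_ite_eq', Finset.mem_univ, if_true,
      ← Finset.sum_mul, hcol]
    ring
  have hlin : ∑ i, θv i * spin (flipAt u x i)
      = ∑ i, θv i * spin (x i) - 2 * (spin (x u) * θv u) := by
    simp only [hs, mul_add, Finset.sum_add_distrib, mul_ite, mul_zero, Finset.sum_ite_eq',
      Finset.mem_univ, if_true]
    ring
  rw [hθ, hθ, hquad, hlin, localField]
  ring

lemma abs_localField_le {p d : ℕ} (G : SimpleGraph (Fin p)) [DecidableRel G.Adj]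
    {θe : Fin p → Fin p → ℝ} {θv : Fin p → ℝ} {β h : ℝ} {u : Fin p} (hβ : 0 ≤ β)
    (hdeg : G.degree u ≤ d) (hedge : ∀ j, G.Adj u j → |θe u j| ≤ β)
    (hnonedge : ∀ j, ¬ G.Adj u j → θe u j = 0) (hfield : |θv u| ≤ h) (x : Fin p → Bool) :
    |localField θe θv u x| ≤ β * d + h := by
  have hsum : ∑ j, θe u j * spin (x j) = ∑ j ∈ G.neighborFinset u, θe u j * spin (x j) := by
    refine (Finset.sum_subset (Finset.subset_univ _) fun j _ hj => ?_).symm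
    rw [hnonedge j (by simpa using hj), zero_mul]
  unfold localField
  refine (abs_add_le _ _).trans (add_le_add ?_ hfield)
  calc |∑ j, θe u j * spin (x j)| ≤ ∑ j ∈ G.neighborFinset u, |θe u j * spin (x j)| := by
        rw [hsum]; exact Finset.abs_sum_le_sum_abs _ _
    _ ≤ ∑ _j ∈ G.neighborFinset u, β := by
        refine Finset.sum_le_sum fun j hj => ?_
        rw [abs_mul, abs_spin, mul_one]
        exact hedge j (by simpa using hj)
    _ = β * G.degree u := by
        rw [Finset.sum_const, SimpleGraph.card_neighborFinset_eq_degree, nsmul_eq_mul, mul_comm]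
    _ ≤ β * d := by gcongr

lemma isingPMF_pos {p : ℕ} (G : SimpleGraph (Fin p)) [DecidableRel G.Adj]
    (θe : Fin p → Fin p → ℝ) (θv : Fin p → ℝ) (x : Fin p → Bool) : 0 < isingPMF G θe θv x :=
  div_pos (Real.exp_pos _) (Finset.sum_pos (fun _ _ => Real.exp_pos _) ⟨x, Finset.mem_univ _⟩)

lemma sum_isingPMF {p : ℕ} (G : SimpleGraph (Fin p)) [DecidableRel G.Adj]
    (θe : Fin p → Fin p → ℝ) (θv : Fin p → ℝ) : ∑ x, isingPMF G θe θv x = 1 := by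
  unfold isingPMF
  rw [← Finset.sum_div]
  exact div_self
    (Finset.sum_pos (fun _ _ => Real.exp_pos _) ⟨fun _ => true, Finset.mem_univ _⟩).ne'

lemma isingPMF_flipAt {p : ℕ} (G : SimpleGraph (Fin p)) [DecidableRel G.Adj]
    {θe : Fin p → Fin p → ℝ} (θv : Fin p → ℝ) (hsym : ∀ i j, θe i j = θe j i)
    (hnonedge : ∀ i j, ¬ G.Adj i j → θe i j = 0) (u : Fin p) (x : Fin p → Bool) :
    isingPMF G θe θv (flipAt u x)
      = Real.exp (-(2 * (spin (x u) * localField θe θv u x))) * isingPMF G θe θv x := by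
  rw [isingPMF, energy_flipAt G θv hsym hnonedge, sub_eq_neg_add, Real.exp_add, isingPMF,
    mul_div_assoc]

lemma one_sub_exp_eq_tanh_mul {b : Bool} (l : ℝ) :
    (1 - Real.exp (-(2 * (spin b * l)))) * spin b
      = Real.tanh l * (1 + Real.exp (-(2 * (spin b * l)))) := by
  have hc := Real.cosh_pos l
  have he : Real.exp l * Real.exp (-l) = 1 := by rw [← Real.exp_add]; simp
  have h1 : Real.exp l ≠ 0 := (Real.exp_pos l).ne'
  have h2 : Real.exp (-l) ≠ 0 := (Real.exp_pos _).ne'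
  rw [Real.tanh_eq_sinh_div_cosh, div_mul_eq_mul_div, eq_div_iff hc.ne', Real.sinh_eq,
    Real.cosh_eq]
  cases b
  · have : Real.exp (-(2 * (spin false * l))) = Real.exp l * Real.exp l := by
      rw [← Real.exp_add]; simp [spin]; ring
    rw [this]
    simp only [spin, Bool.false_eq_true, if_false]
    linear_combination Real.exp l * he
  · have : Real.exp (-(2 * (spin true * l))) = Real.exp (-l) * Real.exp (-l) := by
      rw [← Real.exp_add]; simp [spin]; ring
    rw [this]
    simp only [spin, if_true]
    linear_combination -Real.exp (-l) * he

/-- Given the other spins, the spin at `u` has mean `tanh` of the local field. -/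
lemma sum_isingPMF_mul_spin {p : ℕ} (G : SimpleGraph (Fin p)) [DecidableRel G.Adj]
    {θe : Fin p → Fin p → ℝ} (θv : Fin p → ℝ) (hsym : ∀ i j, θe i j = θe j i)
    (hnonedge : ∀ i j, ¬ G.Adj i j → θe i j = 0) (u : Fin p) {F : (Fin p → Bool) → ℝ}
    (hF : ∀ x, F (flipAt u x) = F x) :
    ∑ x, isingPMF G θe θv x * (spin (x u) * F x)
      = ∑ x, isingPMF G θe θv x * (Real.tanh (localField θe θv u x) * F x) := by
  have huu : θe u u = 0 := hnonedge u u G.irrefl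
  have h1 := sum_comp_flipAt u fun x => isingPMF G θe θv x * (spin (x u) * F x)
  have h2 := sum_comp_flipAt u fun x =>
    isingPMF G θe θv x * (Real.tanh (localField θe θv u x) * F x)
  simp only [hF, flipAt_self, spin_not, localField_flipAt_self θv huu,
    isingPMF_flipAt G θv hsym hnonedge] at h1 h2
  have h3 : ∑ x, (isingPMF G θe θv x * (spin (x u) * F x)
        + Real.exp (-(2 * (spin (x u) * localField θe θv u x))) * isingPMF G θe θv x
          * (-spin (x u) * F x))
      = ∑ x, (isingPMF G θe θv x * (Real.tanh (localField θe θv u x) * F x)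
        + Real.exp (-(2 * (spin (x u) * localField θe θv u x))) * isingPMF G θe θv x
          * (Real.tanh (localField θe θv u x) * F x)) := by
    refine Finset.sum_congr rfl fun x _ => ?_
    linear_combination (isingPMF G θe θv x * F x)
      * one_sub_exp_eq_tanh_mul (b := x u) (localField θe θv u x)
  rw [Finset.sum_add_distrib, Finset.sum_add_distrib, h1, h2] at h3
  linarith

lemma replicaPMF_flipAt {p : ℕ} (μ : (Fin p → Bool) → ℝ) {S : Finset (Fin p)} {i : Fin p}
    (hi : i ∉ S) (y z : Fin p → Bool) :
    replicaPMF μ S (flipAt i y) z * μ y = μ (flipAt i y) * replicaPMF μ S y z := by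
  unfold replicaPMF
  rw [← (agree_flipAt hi y).congr_left]
  split_ifs <;> ring

/-- A function whose value jumps by at least `2α` when the spin at `i ∉ S` is flipped has a
conditional variance given `X_S` which is bounded below. -/
lemma le_sum_replicaPMF_mul_sq {p : ℕ} {μ : (Fin p → Bool) → ℝ} (hμ : ∀ x, 0 < μ x)
    (hμ1 : ∑ x, μ x = 1) {S : Finset (Fin p)} {i : Fin p} (hi : i ∉ S) {ρ α : ℝ}
    (hρ : 0 ≤ ρ) (hρ1 : ρ ≤ 1) (hflip : ∀ x, ρ * μ x ≤ μ (flipAt i x))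
    {W : (Fin p → Bool) → ℝ} (hW : ∀ x, 4 * α ^ 2 ≤ (W (flipAt i x) - W x) ^ 2) :
    ρ * α ^ 2 ≤ ∑ y, ∑ z, replicaPMF μ S y z * (W y - W z) ^ 2 := by
  have hterm : ∀ y, 2 * ρ * α ^ 2 * μ y ≤ ∑ z, replicaPMF μ S y z * (W y - W z) ^ 2
      + ∑ z, replicaPMF μ S (flipAt i y) z * (W (flipAt i y) - W z) ^ 2 := by
    intro y
    rw [← Finset.sum_add_distrib, ← sum_replicaPMF hμ S y, Finset.mul_sum]
    refine Finset.sum_le_sum fun z _ => ?_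
    have hk := replicaPMF_nonneg hμ S y z
    have hk' : ρ * replicaPMF μ S y z ≤ replicaPMF μ S (flipAt i y) z := by
      refine le_of_mul_le_mul_right ?_ (hμ y)
      rw [replicaPMF_flipAt μ hi]
      nlinarith [mul_le_mul_of_nonneg_right (hflip y) hk]
    have hsq : 2 * α ^ 2 ≤ (W y - W z) ^ 2 + (W (flipAt i y) - W z) ^ 2 := by
      nlinarith [hW y, sq_nonneg ((W y - W z) + (W (flipAt i y) - W z))]
    calc 2 * ρ * α ^ 2 * replicaPMF μ S y z
        = ρ * replicaPMF μ S y z * (2 * α ^ 2) := by ring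
      _ ≤ ρ * replicaPMF μ S y z * ((W y - W z) ^ 2 + (W (flipAt i y) - W z) ^ 2) :=
          mul_le_mul_of_nonneg_left hsq (mul_nonneg hρ hk)
      _ = ρ * replicaPMF μ S y z * (W y - W z) ^ 2
            + ρ * replicaPMF μ S y z * (W (flipAt i y) - W z) ^ 2 := by ring
      _ ≤ _ := add_le_add
          (mul_le_mul_of_nonneg_right (mul_le_of_le_one_left hk hρ1) (sq_nonneg _))
          (mul_le_mul_of_nonneg_right hk' (sq_nonneg _))
  have hsum := Finset.sum_le_sum fun y (_ : y ∈ Finset.univ) => hterm y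
  rw [← Finset.mul_sum, hμ1, Finset.sum_add_distrib,
    sum_comp_flipAt i fun y => ∑ z, replicaPMF μ S y z * (W y - W z) ^ 2] at hsum
  linarith

lemma sum_replicaPMF_mul_sub {p : ℕ} (μ : (Fin p → Bool) → ℝ) (S : Finset (Fin p))
    (T W : (Fin p → Bool) → ℝ) :
    ∑ y, ∑ z, replicaPMF μ S y z * (T y * (W y - W z))
      = (∑ y, ∑ z, replicaPMF μ S y z * ((T y - T z) * (W y - W z))) / 2 := by
  have hswap : ∑ y, ∑ z, replicaPMF μ S y z * (T y * (W y - W z))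
      = ∑ y, ∑ z, replicaPMF μ S y z * (T z * (W z - W y)) := by
    rw [Finset.sum_comm]
    exact Finset.sum_congr rfl fun y _ => Finset.sum_congr rfl fun z _ => by
      rw [replicaPMF_comm]
  have hadd : ∑ y, ∑ z, replicaPMF μ S y z * ((T y - T z) * (W y - W z))
      = ∑ y, ∑ z, replicaPMF μ S y z * (T y * (W y - W z))
        + ∑ y, ∑ z, replicaPMF μ S y z * (T z * (W z - W y)) := by
    simp only [← Finset.sum_add_distrib]
    exact Finset.sum_congr rfl fun y _ => Finset.sum_congr rfl fun z _ => by ring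
  rw [hadd, ← hswap]
  ring

/-- The covariance of `X_u` with the weighted sum of the spins of its neighbors outside `S`,
given `X_S`, is bounded below. -/
lemma le_sum_mul_avgCov {p d : ℕ} (G : SimpleGraph (Fin p)) [DecidableRel G.Adj]
    {θe : Fin p → Fin p → ℝ} {θv : Fin p → ℝ} {α β h : ℝ} (hα : 0 < α) (hαβ : α ≤ β)
    (hh : 0 ≤ h) (hdeg : ∀ v, G.degree v ≤ d) (hsym : ∀ i j, θe i j = θe j i)
    (hedge : ∀ i j, G.Adj i j → α ≤ |θe i j| ∧ |θe i j| ≤ β)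
    (hnonedge : ∀ i j, ¬ G.Adj i j → θe i j = 0) (hfield : ∀ i, |θv i| ≤ h)
    {u : Fin p} {S : Finset (Fin p)} (hu : u ∉ S) (hN : ¬ G.neighborFinset u ⊆ S) :
    2 * α ^ 2 * deltaLB β h d ^ 2
      ≤ ∑ i ∈ G.neighborFinset u \ S, θe u i * avgCov (isingPMF G θe θv) u i S := by
  set μ := isingPMF G θe θv with hμdef
  set N := G.neighborFinset u \ S with hNdef
  set ρ := Real.exp (-(2 * (β * d + h))) with hρdef
  have hμ : ∀ x, 0 < μ x := isingPMF_pos G θe θv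
  have hβ : 0 ≤ β := hα.le.trans hαβ
  have hρ : 0 < ρ := Real.exp_pos _
  have hρ1 : ρ ≤ 1 := Real.exp_le_one_iff.2 (by
    have : 0 ≤ β * d + h := by positivity
    linarith)
  have hL : ∀ v x, |localField θe θv v x| ≤ β * d + h := fun v x =>
    abs_localField_le G hβ (hdeg v) (fun j hj => (hedge v j hj).2) (hnonedge v) (hfield v) x
  let W : (Fin p → Bool) → ℝ := fun x => ∑ i ∈ N, θe u i * spin (x i)
  let T : (Fin p → Bool) → ℝ := fun x => Real.tanh (localField θe θv u x)
  have huN : u ∉ N := by simp [hNdef]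
  have hWu : ∀ x, W (flipAt u x) = W x := fun x =>
    Finset.sum_congr rfl fun i hi => by rw [flipAt_of_ne (ne_of_mem_of_not_mem hi huN)]
  have hcov : ∑ i ∈ N, θe u i * avgCov μ u i S
      = ∑ y, ∑ z, replicaPMF μ S y z * (spin (y u) * (W y - W z)) := by
    simp only [avgCov, Finset.mul_sum]
    rw [Finset.sum_comm]
    refine Finset.sum_congr rfl fun y _ => ?_
    rw [Finset.sum_comm]
    refine Finset.sum_congr rfl fun z _ => ?_
    simp only [W]
    rw [← Finset.sum_sub_distrib, Finset.mul_sum, Finset.mul_sum]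
    exact Finset.sum_congr rfl fun i _ => by ring
  have hmean : ∑ y, ∑ z, replicaPMF μ S y z * (spin (y u) * (W y - W z))
      = ∑ y, ∑ z, replicaPMF μ S y z * (T y * (W y - W z)) := by
    let F : (Fin p → Bool) → ℝ := fun y => (∑ z, replicaPMF μ S y z * (W y - W z)) / μ y
    have hF : ∀ y, F (flipAt u y) = F y := by
      intro y
      simp only [F, hWu]
      rw [div_eq_div_iff (hμ _).ne' (hμ _).ne', Finset.sum_mul, Finset.sum_mul]
      refine Finset.sum_congr rfl fun z _ => ?_
      linear_combination (W y - W z) * replicaPMF_flipAt μ hu y z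
    have hpull : ∀ (c : (Fin p → Bool) → ℝ) (y : Fin p → Bool),
        ∑ z, replicaPMF μ S y z * (c y * (W y - W z)) = μ y * (c y * F y) := by
      intro c y
      have hy := (hμ y).ne'
      calc _ = c y * ∑ z, replicaPMF μ S y z * (W y - W z) := by
            rw [Finset.mul_sum]
            exact Finset.sum_congr rfl fun z _ => by ring
        _ = _ := by simp only [F]; field_simp
    rw [Finset.sum_congr rfl fun y _ => hpull (fun x => spin (x u)) y,
      Finset.sum_congr rfl fun y _ => hpull T y]
    exact sum_isingPMF_mul_spin G θv hsym hnonedge u hF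
  have hfieldW : ∀ y z, agree S y z →
      localField θe θv u y - localField θe θv u z = W y - W z := by
    intro y z hyz
    simp only [localField, W]
    rw [add_sub_add_right_eq_sub, ← Finset.sum_sub_distrib, ← Finset.sum_sub_distrib]
    refine (Finset.sum_subset (Finset.subset_univ _) fun j _ hj => ?_).symm
    by_cases hjS : j ∈ S
    · rw [hyz j hjS, sub_self]
    · have hadj : ¬ G.Adj u j := fun hadj => hj (by simp [hNdef, hadj, hjS])
      rw [hnonedge u j hadj, zero_mul, zero_mul, sub_zero]
  have hmono : ρ * ∑ y, ∑ z, replicaPMF μ S y z * (W y - W z) ^ 2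
      ≤ ∑ y, ∑ z, replicaPMF μ S y z * ((T y - T z) * (W y - W z)) := by
    simp only [Finset.mul_sum]
    refine Finset.sum_le_sum fun y _ => Finset.sum_le_sum fun z _ => ?_
    by_cases hyz : agree S y z
    · rw [mul_left_comm]
      refine mul_le_mul_of_nonneg_left ?_ (replicaPMF_nonneg hμ S y z)
      rw [← hfieldW y z hyz]
      exact exp_neg_mul_sq_le_tanh_sub (hL u y) (hL u z)
    · simp [replicaPMF, hyz]
  obtain ⟨i, hiN, hiS⟩ := Finset.not_subset.1 hN
  have hiN' : i ∈ N := Finset.mem_sdiff.2 ⟨hiN, hiS⟩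
  have hflip : ∀ x, ρ * μ x ≤ μ (flipAt i x) := by
    intro x
    rw [hμdef, isingPMF_flipAt G θv hsym hnonedge]
    refine mul_le_mul_of_nonneg_right (Real.exp_le_exp.2 ?_) (hμ x).le
    have h1 : |spin (x i) * localField θe θv i x| ≤ β * d + h := by
      rw [abs_mul, abs_spin, one_mul]
      exact hL i x
    linarith [le_abs_self (spin (x i) * localField θe θv i x)]
  have hjump : ∀ x, 4 * α ^ 2 ≤ (W (flipAt i x) - W x) ^ 2 := by
    intro x
    have hdiff : W (flipAt i x) - W x = -2 * θe u i * spin (x i) := by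
      simp only [W]
      rw [← Finset.sum_sub_distrib, Finset.sum_eq_single_of_mem i hiN']
      · rw [flipAt_self, spin_not]; ring
      · intro j _ hj
        rw [flipAt_of_ne hj, sub_self]
    have hθ : α ^ 2 ≤ θe u i ^ 2 := by
      rw [← sq_abs (θe u i)]
      exact pow_le_pow_left₀ hα.le (hedge u i (by simpa using hiN)).1 2
    have : (W (flipAt i x) - W x) ^ 2 = 4 * θe u i ^ 2 := by
      rw [hdiff]
      linear_combination 4 * θe u i ^ 2 * spin_mul_self (x i)
    linarith
  have hvar := le_sum_replicaPMF_mul_sq hμ (sum_isingPMF G θe θv) hiS hρ.le hρ1 hflip hjump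
  rw [hcov, hmean, sum_replicaPMF_mul_sub]
  have hδ : deltaLB β h d = 1 / 2 * ρ := rfl
  rw [hδ]
  nlinarith [mul_le_mul_of_nonneg_left hvar hρ.le]

lemma exists_two_mul_tauStar_sq_le_condMI {p d : ℕ} (G : SimpleGraph (Fin p))
    [DecidableRel G.Adj] {θe : Fin p → Fin p → ℝ} {θv : Fin p → ℝ} {α β h : ℝ} (hα : 0 < α)
    (hαβ : α ≤ β) (hh : 0 ≤ h) (hdeg : ∀ v, G.degree v ≤ d) (hsym : ∀ i j, θe i j = θe j i)
    (hedge : ∀ i j, G.Adj i j → α ≤ |θe i j| ∧ |θe i j| ≤ β)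
    (hnonedge : ∀ i j, ¬ G.Adj i j → θe i j = 0) (hfield : ∀ i, |θv i| ≤ h)
    {u : Fin p} {S : Finset (Fin p)} (hu : u ∉ S) (hN : ¬ G.neighborFinset u ⊆ S) :
    ∃ i ∈ G.neighborFinset u \ S,
      2 * tauStar α β h d ^ 2 ≤ condMI (isingPMF G θe θv) u i S := by
  set δ := deltaLB β h d with hδdef
  have hβ : 0 < β := hα.trans_le hαβ
  have hδ : 0 < δ := mul_pos (by norm_num) (Real.exp_pos _)
  have hδ1 : δ ≤ 1 := by
    have : Real.exp (-(2 * (β * d + h))) ≤ 1 := Real.exp_le_one_iff.2 (by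
      have : 0 ≤ β * d + h := by positivity
      linarith)
    rw [hδdef, deltaLB]
    linarith
  have hne : (G.neighborFinset u \ S).Nonempty := Finset.sdiff_nonempty.2 hN
  have hcard : ((G.neighborFinset u \ S).card : ℝ) ≤ d := by
    have h1 := Finset.card_le_card (Finset.sdiff_subset (s := G.neighborFinset u) (t := S))
    rw [SimpleGraph.card_neighborFinset_eq_degree] at h1
    exact_mod_cast h1.trans (hdeg u)
  have hd : 1 ≤ d := by
    have h1 : (1 : ℝ) ≤ (G.neighborFinset u \ S).card := by exact_mod_cast hne.card_pos
    exact_mod_cast h1.trans hcard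
  have hd0 : (0 : ℝ) < d := by exact_mod_cast hd
  have hsum := le_sum_mul_avgCov G hα hαβ hh hdeg hsym hedge hnonedge hfield hu hN
  have hconst : ∑ _i ∈ G.neighborFinset u \ S, 2 * α ^ 2 * δ ^ 2 / d ≤ 2 * α ^ 2 * δ ^ 2 := by
    rw [Finset.sum_const, nsmul_eq_mul, mul_div_assoc', div_le_iff₀ hd0, mul_comm]
    exact mul_le_mul_of_nonneg_left hcard (by positivity)
  obtain ⟨i, hi, hle⟩ := Finset.exists_le_of_sum_le hne (hconst.trans hsum)
  refine ⟨i, hi, ?_⟩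
  obtain ⟨hiN, hiS⟩ := Finset.mem_sdiff.1 hi
  have hadj : G.Adj u i := by simpa using hiN
  have hMI := avgCov_sq_le_condMI (isingPMF_pos G θe θv) (sum_isingPMF G θe θv) hadj.ne hiS
  set c := avgCov (isingPMF G θe θv) u i S
  have hc : 2 * α ^ 2 * δ ^ 2 / (d * β) ≤ |c| := by
    rw [← div_div, div_le_iff₀ hβ]
    calc _ ≤ |θe u i * c| := hle.trans (le_abs_self _)
      _ = |θe u i| * |c| := abs_mul _ _
      _ ≤ |c| * β := by
          rw [mul_comm]
          exact mul_le_mul_of_nonneg_left (hedge u i hadj).2 (abs_nonneg _)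
  have hτ : tauStar α β h d ≤ 2 * α ^ 2 * δ ^ 2 / (d * β) / 32 := by
    have hpow : δ ^ (4 * d + 1) ≤ δ ^ 2 := pow_le_pow_of_le_one hδ.le hδ1 (by omega)
    calc tauStar α β h d = α ^ 2 * δ ^ (4 * d + 1) / (16 * d * β) := rfl
      _ ≤ α ^ 2 * δ ^ 2 / (16 * d * β) := by gcongr
      _ = _ := by field_simp; norm_num
  have hτ0 : 0 ≤ tauStar α β h d := by
    change 0 ≤ α ^ 2 * δ ^ (4 * d + 1) / (16 * d * β)
    positivity
  have hτc : tauStar α β h d ≤ |c| / 32 := by linarith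
  have hτsq := pow_le_pow_left₀ hτ0 hτc 2
  rw [div_pow, sq_abs] at hτsq
  nlinarith [sq_nonneg c]

/-- every node has a neighbor (outside any set not containing the whole
neighborhood) with conditional mutual information at least `2(τ*)²`; in particular, taking
`S = ∅`, every non-isolated node has a neighbor with mutual information at least `2(τ*)²`. -/
theorem stmt13
    {p d : ℕ} (G : SimpleGraph (Fin p)) [DecidableRel G.Adj]
    (θe : Fin p → Fin p → ℝ) (θv : Fin p → ℝ) (α β h : ℝ)
    (hα : 0 < α) (hαβ : α ≤ β) (hh : 0 ≤ h)
    (hdeg : ∀ v, G.degree v ≤ d)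
    (hsym : ∀ i j, θe i j = θe j i)
    (hedge : ∀ i j, G.Adj i j → α ≤ |θe i j| ∧ |θe i j| ≤ β)
    (hnonedge : ∀ i j, ¬ G.Adj i j → θe i j = 0)
    (hfield : ∀ i, |θv i| ≤ h) :
    (∀ (u : Fin p) (S : Finset (Fin p)), u ∉ S → ¬ G.neighborFinset u ⊆ S →
      ∃ i ∈ G.neighborFinset u \ S,
        condMI (isingPMF G θe θv) u i S ≥ 2 * tauStar α β h d ^ 2)
    ∧ (∀ u : Fin p, (G.neighborFinset u).Nonempty →
      ∃ i ∈ G.neighborFinset u,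
        condMI (isingPMF G θe θv) u i ∅ ≥ 2 * tauStar α β h d ^ 2) := by
  have key := fun (u : Fin p) (S : Finset (Fin p)) (hu : u ∉ S)
      (hN : ¬ G.neighborFinset u ⊆ S) =>
    exists_two_mul_tauStar_sq_le_condMI G hα hαβ hh hdeg hsym hedge hnonedge hfield hu hN
  refine ⟨key, fun u hu => ?_⟩
  simpa using key u ∅ (Finset.notMem_empty u)
    (fun hsub => hu.ne_empty (Finset.subset_empty.1 hsub))
end
end

section
/- (Deterministic stability of the average conditional influence.) Let u, i ∈ V be distinct, let S ⊆ V∖{u,i} with |S| ≤ ℓ, and set q := δ^ℓ. Let P̂ be any probability distribution on {−1,+1}^V such that P̂(X_{S∪{i}} = z) > 0 for every configuration z of S∪{i}, and suppose that |P̂(X_W = x_W) − P(X_W = x_W)| ≤ γ for every subset W ⊆ V with |W| ≤ ℓ+2 and every configuration x_W. Then |ν̄_P(u,i,S) − ν̄_{P̂}(u,i,S)| ≤ 12γ/q, where ν̄_{P̂} denotes the average conditional influence computed with P̂ in place of P. -/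
noncomputable section

open Real Finset

lemma prob_split {p : ℕ} (μ : (Fin p → Bool) → ℝ) (A : (Fin p → Bool) → Prop) (i : Fin p) :
    prob μ A = prob μ (fun x => x i = true ∧ A x) + prob μ (fun x => x i = false ∧ A x) := by
  classical
  unfold prob
  rw [← Finset.sum_add_distrib]
  refine Finset.sum_congr rfl fun x _ => ?_
  cases hx : x i <;> by_cases hA : A x <;> simp [hx, hA]

lemma prob_nonneg_of_nonneg {p : ℕ} {μ : (Fin p → Bool) → ℝ} (hμ : ∀ x, 0 ≤ μ x)
    (A : (Fin p → Bool) → Prop) : 0 ≤ prob μ A :=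
  Finset.sum_nonneg fun x _ => by split_ifs <;> simp [hμ x]

lemma prob_agree_pos_of_pos {p : ℕ} {μ : (Fin p → Bool) → ℝ} (hμ : ∀ x, 0 < μ x)
    (S : Finset (Fin p)) (σ : Fin p → Bool) : 0 < prob μ (agree S σ) :=
  Finset.sum_pos' (fun x _ => by split_ifs <;> simp [(hμ x).le])
    ⟨σ, Finset.mem_univ _, by simp [agree, hμ σ]⟩

lemma agree_insert_update {p : ℕ} {S : Finset (Fin p)} {i : Fin p} (hi : i ∉ S)
    (σ : Fin p → Bool) (b : Bool) :
    agree (insert i S) (Function.update σ i b) = fun x => x i = b ∧ agree S σ x := by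
  funext x
  simp only [agree, Finset.forall_mem_insert, Function.update_self, eq_iff_iff]
  refine and_congr_right fun _ => forall₂_congr fun j hj => ?_
  rw [Function.update_of_ne (ne_of_mem_of_not_mem hj hi)]

lemma agree_congr {p : ℕ} {S : Finset (Fin p)} {σ τ : Fin p → Bool} (h : agree S σ τ) :
    agree S τ = agree S σ := by
  funext x
  exact propext (forall₂_congr fun j hj => by rw [h j hj])

/-- The contribution of the configuration `σ` of `S` to the average conditional influence. -/
def localInf {p : ℕ} (μ : (Fin p → Bool) → ℝ) (u i : Fin p) (S : Finset (Fin p))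
    (σ : Fin p → Bool) : ℝ :=
  prob μ (agree S σ) * (lamWeight μ i S σ * |condInf μ u i S σ|)

/-- The configuration taking the value `true` exactly on `T`. -/
def indicatorConfig {p : ℕ} (T : Finset (Fin p)) (j : Fin p) : Bool := decide (j ∈ T)

lemma avgInf_eq_sum_powerset {p : ℕ} (μ : (Fin p → Bool) → ℝ) (u i : Fin p)
    (S : Finset (Fin p)) :
    avgInf μ u i S = ∑ T ∈ S.powerset, localInf μ u i S (indicatorConfig T) := by
  classical
  unfold avgInf
  rw [← Finset.sum_fiberwise_of_maps_to (s := Finset.univ) (t := S.powerset)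
    (g := fun x : Fin p → Bool => S.filter fun j => x j = true)
    (fun x _ => Finset.mem_powerset.2 (Finset.filter_subset _ _))]
  refine Finset.sum_congr rfl fun T hT => ?_
  have hTS := Finset.mem_powerset.1 hT
  have key : ∀ x : Fin p → Bool,
      (S.filter fun j => x j = true) = T ↔ agree S (indicatorConfig T) x := by
    intro x
    constructor
    · rintro rfl j hj
      simp [indicatorConfig, hj]
    · intro hx
      ext j
      rw [Finset.mem_filter]
      constructor
      · rintro ⟨hj, h⟩
        rw [hx j hj] at h
        simpa [indicatorConfig] using h
      · intro hj
        refine ⟨hTS hj, ?_⟩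
        rw [hx j (hTS hj)]
        simpa [indicatorConfig] using hj
  rw [localInf, prob, Finset.sum_mul, Finset.sum_filter]
  refine Finset.sum_congr rfl fun x _ => ?_
  by_cases hx : agree S (indicatorConfig T) x
  · rw [if_pos ((key x).2 hx), if_pos hx]
    simp only [lamWeight, condInf, agree_congr hx]
  · rw [if_neg (mt (key x).1 hx), if_neg hx, zero_mul]

lemma localInf_eq {p : ℕ} {μ : (Fin p → Bool) → ℝ} {u i : Fin p} {S : Finset (Fin p)}
    {σ : Fin p → Bool} (h1 : 0 < prob μ (fun x => x i = true ∧ agree S σ x))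
    (h0 : 0 < prob μ (fun x => x i = false ∧ agree S σ x)) :
    localInf μ u i S σ =
      2 * |prob μ (fun x => x u = true ∧ x i = true ∧ agree S σ x)
        - prob μ (fun x => x i = true ∧ agree S σ x)
          * prob μ (fun x => x u = true ∧ agree S σ x) / prob μ (agree S σ)| := by
  have hs := prob_split μ (agree S σ) i
  have hg := prob_split μ (fun x => x u = true ∧ agree S σ x) i
  have hcomm : ∀ b, (fun x : Fin p → Bool => x i = b ∧ x u = true ∧ agree S σ x) =
      fun x => x u = true ∧ x i = b ∧ agree S σ x := fun b =>
    funext fun x => propext and_left_comm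
  rw [hcomm, hcomm] at hg
  unfold localInf lamWeight condInf condProb
  rw [hs, hg]
  set a := prob μ (fun x => x u = true ∧ x i = true ∧ agree S σ x)
  set c := prob μ (fun x => x u = true ∧ x i = false ∧ agree S σ x)
  set e := prob μ (fun x => x i = true ∧ agree S σ x)
  set b := prob μ (fun x => x i = false ∧ agree S σ x)
  have hw : 0 < (e + b) * (e / (e + b) * (b / (e + b))) := by positivity
  calc (e + b) * (2 * (e / (e + b)) * (b / (e + b)) * |a / e - c / b|)
      = 2 * (|(e + b) * (e / (e + b) * (b / (e + b)))| * |a / e - c / b|) := by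
        rw [abs_of_pos hw]; ring
    _ = 2 * |a - e * (a + c) / (e + b)| := by
        rw [← abs_mul]
        congr 2
        field_simp
        ring

lemma abs_two_mul_abs_sub_le {a e g s a' e' g' s' γ : ℝ} (hs : 0 < s) (hs' : 0 < s')
    (hg0 : 0 ≤ g) (hgs : g ≤ s) (he0 : 0 ≤ e') (hes : e' ≤ s')
    (ha : |a' - a| ≤ γ) (he : |e' - e| ≤ γ) (hg : |g' - g| ≤ γ) (hss : |s' - s| ≤ γ) :
    |2 * |a - e * g / s| - (2 * |a' - e' * g' / s'|)| ≤ 8 * γ := by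
  have hγ : 0 ≤ γ := (abs_nonneg _).trans ha
  have hx : |g / s| ≤ 1 := by
    rw [abs_of_nonneg (by positivity)]; exact (div_le_one hs).2 hgs
  have hy : |e' / s'| ≤ 1 := by
    rw [abs_of_nonneg (by positivity)]; exact (div_le_one hs').2 hes
  have key : (a - e * g / s) - (a' - e' * g' / s') =
      -(a' - a) + (e' - e) * (g / s) + (e' / s') * ((g' - g) - (s' - s) * (g / s)) := by
    field_simp
    ring
  have t1 : |(e' - e) * (g / s)| ≤ γ := by
    rw [abs_mul]
    nlinarith [abs_nonneg (e' - e), abs_nonneg (g / s)]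
  have t2 : |(s' - s) * (g / s)| ≤ γ := by
    rw [abs_mul]
    nlinarith [abs_nonneg (s' - s), abs_nonneg (g / s)]
  have t3 : |(e' / s') * ((g' - g) - (s' - s) * (g / s))| ≤ 2 * γ := by
    have := abs_sub (g' - g) ((s' - s) * (g / s))
    rw [abs_mul]
    nlinarith [abs_nonneg ((g' - g) - (s' - s) * (g / s)), abs_nonneg (e' / s')]
  have t : |(a - e * g / s) - (a' - e' * g' / s')| ≤ 4 * γ := by
    rw [key]
    refine (abs_add_le _ _).trans ?_
    have := abs_add_le (-(a' - a)) ((e' - e) * (g / s))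
    rw [abs_neg] at this
    linarith
  have := abs_abs_sub_abs_le (a - e * g / s) (a' - e' * g' / s')
  rw [← mul_sub, abs_mul, abs_two]
  linarith

lemma abs_localInf_sub_le {p : ℕ} {μ ν : (Fin p → Bool) → ℝ} {u i : Fin p}
    {S : Finset (Fin p)} (hμ : ∀ x, 0 ≤ μ x) (hν : ∀ x, 0 ≤ ν x)
    (hui : u ≠ i) (huS : u ∉ S) (hiS : i ∉ S) {ℓ : ℕ} (hS : S.card ≤ ℓ) {γ : ℝ}
    (hμpos : ∀ z, 0 < prob μ (agree (insert i S) z))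
    (hνpos : ∀ z, 0 < prob ν (agree (insert i S) z))
    (hclose : ∀ (W : Finset (Fin p)) (σ : Fin p → Bool), W.card ≤ ℓ + 2 →
      |prob ν (agree W σ) - prob μ (agree W σ)| ≤ γ) (σ : Fin p → Bool) :
    |localInf μ u i S σ - localInf ν u i S σ| ≤ 8 * γ := by
  have hci : (insert i S).card ≤ ℓ + 1 := (Finset.card_insert_le _ _).trans (by omega)
  have hcu : (insert u S).card ≤ ℓ + 2 := (Finset.card_insert_le _ _).trans (by omega)
  have hcui : (insert u (insert i S)).card ≤ ℓ + 2 :=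
    (Finset.card_insert_le _ _).trans (by omega)
  have huiS : u ∉ insert i S := by simp [hui, huS]
  have hμi : ∀ b, 0 < prob μ (fun x => x i = b ∧ agree S σ x) := fun b => by
    rw [← agree_insert_update hiS]; exact hμpos _
  have hνi : ∀ b, 0 < prob ν (fun x => x i = b ∧ agree S σ x) := fun b => by
    rw [← agree_insert_update hiS]; exact hνpos _
  have hμs := prob_split μ (agree S σ) i
  have hνs := prob_split ν (agree S σ) i
  have hμu := prob_split μ (agree S σ) u
  have hμu0 := prob_nonneg_of_nonneg hμ (fun x => x u = false ∧ agree S σ x)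
  rw [localInf_eq (hμi true) (hμi false), localInf_eq (hνi true) (hνi false)]
  refine abs_two_mul_abs_sub_le ?_ ?_ (prob_nonneg_of_nonneg hμ _) ?_
    (prob_nonneg_of_nonneg hν _) ?_ ?_ ?_ ?_ (hclose S σ (by omega))
  · linarith [hμi true, hμi false]
  · linarith [hνi true, hνi false]
  · linarith
  · linarith [hνi false]
  · have := hclose _ (Function.update (Function.update σ i true) u true) hcui
    rwa [agree_insert_update huiS, agree_insert_update hiS] at this
  · have := hclose _ (Function.update σ i true) (hci.trans (by omega))
    rwa [agree_insert_update hiS] at this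
  · have := hclose _ (Function.update σ u true) hcu
    rwa [agree_insert_update huS] at this

lemma two_pow_le_one_div_deltaLB_pow {β h : ℝ} (hβ : 0 ≤ β) (hh : 0 ≤ h) (d : ℕ) {k ℓ : ℕ}
    (hk : k ≤ ℓ) : (2 : ℝ) ^ k ≤ 1 / deltaLB β h d ^ ℓ := by
  have hpos : 0 < deltaLB β h d := by unfold deltaLB; positivity
  have hle : deltaLB β h d ≤ 1 / 2 := by
    have : Real.exp (-(2 * (β * d + h))) ≤ 1 := Real.exp_le_one_iff.2 (by
      have : 0 ≤ 2 * (β * d + h) := by positivity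
      linarith)
    unfold deltaLB
    linarith
  calc (2 : ℝ) ^ k ≤ 2 ^ ℓ := pow_le_pow_right₀ (by norm_num) hk
    _ = 1 / (1 / 2) ^ ℓ := by simp
    _ ≤ 1 / deltaLB β h d ^ ℓ := by gcongr

/-- deterministic stability of the average conditional influence. -/
theorem stmt15
    {p d : ℕ} (G : SimpleGraph (Fin p)) [DecidableRel G.Adj]
    (θe : Fin p → Fin p → ℝ) (θv : Fin p → ℝ) (α β h : ℝ)
    (hα : 0 < α) (hαβ : α ≤ β) (hh : 0 ≤ h)
    (hdeg : ∀ v, G.degree v ≤ d)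
    (hsym : ∀ i j, θe i j = θe j i)
    (hedge : ∀ i j, G.Adj i j → α ≤ |θe i j| ∧ |θe i j| ≤ β)
    (hnonedge : ∀ i j, ¬ G.Adj i j → θe i j = 0)
    (hfield : ∀ i, |θv i| ≤ h)
    (u i : Fin p) (hui : u ≠ i) (S : Finset (Fin p)) (huS : u ∉ S) (hiS : i ∉ S)
    (ℓ : ℕ) (hS : S.card ≤ ℓ) (γ : ℝ)
    (Pb : (Fin p → Bool) → ℝ) (hPbnn : ∀ x, 0 ≤ Pb x) (hPbsum : ∑ x, Pb x = 1)
    (hPbpos : ∀ z : Fin p → Bool, 0 < prob Pb (agree (insert i S) z))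
    (hclose : ∀ (W : Finset (Fin p)) (σ : Fin p → Bool), W.card ≤ ℓ + 2 →
      |prob Pb (agree W σ) - prob (isingPMF G θe θv) (agree W σ)| ≤ γ) :
    |avgInf (isingPMF G θe θv) u i S - avgInf Pb u i S|
      ≤ 12 * γ / deltaLB β h d ^ ℓ := by
  have hγ : 0 ≤ γ := (abs_nonneg _).trans (hclose ∅ (fun _ => true) (by simp))
  have hP := isingPMF_pos G θe θv
  rw [avgInf_eq_sum_powerset, avgInf_eq_sum_powerset, ← Finset.sum_sub_distrib]
  calc _ ≤ ∑ T ∈ S.powerset, |localInf (isingPMF G θe θv) u i S (indicatorConfig T)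
          - localInf Pb u i S (indicatorConfig T)| := Finset.abs_sum_le_sum_abs _ _
    _ ≤ ∑ _T ∈ S.powerset, 8 * γ := Finset.sum_le_sum fun T _ =>
        abs_localInf_sub_le (fun x => (hP x).le) hPbnn hui huS hiS hS
          (prob_agree_pos_of_pos hP _) hPbpos hclose _
    _ = 8 * γ * 2 ^ S.card := by
        rw [Finset.sum_const, Finset.card_powerset, nsmul_eq_mul]
        push_cast
        ring
    _ ≤ 12 * γ * (1 / deltaLB β h d ^ ℓ) := by
        gcongr
        · norm_num
        · exact two_pow_le_one_div_deltaLB_pow (hα.le.trans hαβ) hh d hS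
    _ = 12 * γ / deltaLB β h d ^ ℓ := by ring
end
end

section
/- For all real numbers z and μ with 0 ≤ z ≤ μ, one has tanh(z) ≤ tanh(μ) − (μ − z)·e^{−2μ}. -/
noncomputable section

open Real Finset

/-- For nonnegative `x`, `cosh x` is at most `exp x`. -/
theorem cosh_le_exp_of_nonneg {x : ℝ} (hx : 0 ≤ x) : Real.cosh x ≤ Real.exp x := by
  have h := Real.cosh_add_sinh x
  have hs := Real.sinh_nonneg_iff.2 hx
  linarith

/-- The difference of two values of `tanh` as a single quotient. -/
theorem tanh_sub_tanh (x y : ℝ) :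
    Real.tanh x - Real.tanh y = Real.sinh (x - y) / (Real.cosh x * Real.cosh y) := by
  rw [Real.tanh_eq_sinh_div_cosh, Real.tanh_eq_sinh_div_cosh, Real.sinh_sub,
    div_sub_div _ _ (Real.cosh_pos x).ne' (Real.cosh_pos y).ne']

/-- a concavity estimate for `tanh`. -/
theorem stmt17 (z μ : ℝ) (hz : 0 ≤ z) (hzμ : z ≤ μ) :
    Real.tanh z ≤ Real.tanh μ - (μ - z) * Real.exp (-(2 * μ)) := by
  have hcosh : Real.cosh μ * Real.cosh z ≤ Real.exp (2 * μ) := by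
    rw [two_mul, Real.exp_add]
    exact mul_le_mul (cosh_le_exp_of_nonneg (hz.trans hzμ))
      ((cosh_le_exp_of_nonneg hz).trans (Real.exp_le_exp.2 hzμ))
      (Real.cosh_pos z).le (Real.exp_pos μ).le
  have hpos : 0 < Real.cosh μ * Real.cosh z := mul_pos (Real.cosh_pos μ) (Real.cosh_pos z)
  have hsub : 0 ≤ μ - z := sub_nonneg.2 hzμ
  have hsinh : μ - z ≤ Real.sinh (μ - z) := Real.self_le_sinh_iff.2 hsub
  have key : (μ - z) * Real.exp (-(2 * μ)) ≤ Real.tanh μ - Real.tanh z := by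
    rw [tanh_sub_tanh, Real.exp_neg, ← div_eq_mul_inv]
    exact div_le_div₀ (hsub.trans hsinh) hsinh hpos hcosh
  linarith
end
end
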